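/- arXiv:1110.6144 — 6 statements merged into one kernel-verified Lean document; each statement's English description precedes it below -/
import Mathlib

section
/- Let P ⊆ ℕ. If the complement ℕ \ P contains a Δ-set, then every point y of the spacing shift Σ_P satisfies d*(y) = 0, i.e. the support A_y = {i : y_i = 1} has upper Banach density zero. -/
open Filter Topology

/-- The spacing shift `Σ_P ⊆ {0,1}^ℕ` determined by `P ⊆ ℕ`: a `0`-`1` sequence `x`
(encoded as `x : ℕ → Bool`) belongs to `Σ_P` iff whenever two coordinates are `1`,
the (positive) distance between them lies in `P`. -/
def SpacingShift (P : Set ℕ) : Set (ℕ → Bool) :=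
  {x | ∀ i j : ℕ, i < j → x i = true → x j = true → j - i ∈ P}

/-- The left shift map `σ` on sequences. -/
def shift (x : ℕ → Bool) : ℕ → Bool := fun n => x (n + 1)

/-- The support `A_y = {i : y_i = 1}` of a point of the shift space. -/
def supp (x : ℕ → Bool) : Set ℕ := {i | x i = true}

/-- `A ⊆ ℕ` has density `d`, i.e. `|A ∩ {1,…,n}| / n → d`. -/
def HasDensity (A : Set ℕ) (d : ℝ) : Prop :=
  Tendsto (fun n : ℕ => (Nat.card (A ∩ Set.Icc 1 n : Set ℕ) : ℝ) / n) atTop (𝓝 d)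

/-- The upper density `d̄(A) = limsup_n |A ∩ {1,…,n}| / n`. -/
noncomputable def upperDensity (A : Set ℕ) : ℝ :=
  limsup (fun n : ℕ => (Nat.card (A ∩ Set.Icc 1 n : Set ℕ) : ℝ) / n) atTop

/-- The upper Banach density `d*(A)`: the limsup, as the window length tends to infinity,
of the maximal proportion of elements of `A` in a window of that length. -/
noncomputable def upperBanachDensity (A : Set ℕ) : ℝ :=
  limsup (fun n : ℕ =>
    ⨆ m : ℕ, (Nat.card (A ∩ Set.Icc m (m + n) : Set ℕ) : ℝ) / (n + 1)) atTop

/-- `D ⊆ ℕ` is a Δ-set: it contains the difference set `{s_i - s_j : i > j}` of some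
strictly increasing sequence of natural numbers. -/
def IsDeltaSet (D : Set ℕ) : Prop :=
  ∃ s : ℕ → ℕ, StrictMono s ∧ ∀ i j : ℕ, j < i → s i - s j ∈ D

/-- `D ⊆ ℕ` is a Δ*-set: it meets every Δ-set. -/
def IsDeltaStarSet (D : Set ℕ) : Prop :=
  ∀ D' : Set ℕ, IsDeltaSet D' → (D ∩ D').Nonempty

open Classical in
/-- The standard metric on the shift space: `d(x,y) = 2^{-min{n : x_n ≠ y_n}}`,
and `d(x,x) = 0`. -/
noncomputable def seqDist (x y : ℕ → Bool) : ℝ :=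
  if x = y then 0 else (2 : ℝ)⁻¹ ^ sInf {n : ℕ | x n ≠ y n}

/-- The set `FS((a_n))` of finite sums of a sequence of natural numbers:
all sums `a_{i_1} + ⋯ + a_{i_k}` with `i_1 < ⋯ < i_k`. -/
def FSseq (a : ℕ → ℕ) : Set ℕ :=
  {n | ∃ F : Finset ℕ, F.Nonempty ∧ n = ∑ i ∈ F, a i}

/-- `S ⊆ ℕ` is an IP-set: it contains the finite sums of some sequence of positive
natural numbers. -/
def IsIPSet (S : Set ℕ) : Prop :=
  ∃ a : ℕ → ℕ, (∀ n, 0 < a n) ∧ FSseq a ⊆ S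

/-- The set `FS(A)` of finite sums of distinct elements of a set `A ⊆ ℕ`. -/
def FSset (A : Set ℕ) : Set ℕ :=
  {n | ∃ F : Finset ℕ, ↑F ⊆ A ∧ F.Nonempty ∧ n = ∑ i ∈ F, i}

/-- The spacing shift `(Σ_P, σ_P)` is topologically transitive: some point of `Σ_P`
has forward orbit (under the shift) dense in `Σ_P`. -/
def IsTransitiveShift (P : Set ℕ) : Prop :=
  ∃ x ∈ SpacingShift P, SpacingShift P ⊆ closure {y : ℕ → Bool | ∃ n : ℕ, shift^[n] x = y}

/-- `E ⊆ ℕ` is density intersective: it meets the difference set `A - A` of every set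
`A ⊆ ℕ` of positive upper Banach density. -/
def DensityIntersective (E : Set ℕ) : Prop :=
  ∀ A : Set ℕ, 0 < upperBanachDensity A → ∃ a ∈ A, ∃ a' ∈ A, a' < a ∧ a - a' ∈ E

/-- If the differences of a strictly increasing sequence `s` avoid `P`, the translates by
`s 0, …, s (k - 1)` of the part of the support of `y ∈ Σ_P` in a window are disjoint. -/
lemma mul_card_supp_inter_Icc_le {P : Set ℕ} {s : ℕ → ℕ} (hs : StrictMono s)
    (hP : ∀ i j : ℕ, j < i → s i - s j ∈ Pᶜ) {y : ℕ → Bool} (hy : y ∈ SpacingShift P)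
    (k m n : ℕ) :
    k * Nat.card (supp y ∩ Set.Icc m (m + n) : Set ℕ) ≤ n + 1 + s k := by
  classical
  have hAcard : Nat.card (supp y ∩ Set.Icc m (m + n) : Set ℕ) =
      ((Finset.Icc m (m + n)).filter (fun i => y i = true)).card := by
    rw [Nat.card_coe_set_eq, ← Set.ncard_coe_finset]
    congr 1
    ext i
    simp [supp, and_comm]
  have key : ∀ i j a b : ℕ, y a = true → y b = true → a + s i = b + s j → ¬ j < i := by
    intro i j a b ha hb hab hji
    have hlt := hs hji
    refine hP i j hji ?_
    have := hy a b (by omega) ha hb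
    rwa [show b - a = s i - s j by omega] at this
  have hcard := Finset.card_le_card_of_injOn
    (s := Finset.range k ×ˢ (Finset.Icc m (m + n)).filter (fun i => y i = true))
    (t := Finset.Icc m (m + n + s k)) (fun p => p.2 + s p.1)
    (by
      rintro ⟨i, a⟩ hp
      simp only [Finset.coe_product, Set.mem_prod, Finset.mem_coe, Finset.mem_range,
        Finset.mem_filter, Finset.mem_Icc] at hp ⊢
      have := hs hp.1
      omega)
    (by
      rintro ⟨i, a⟩ hp ⟨j, b⟩ hq hab
      simp only [Finset.coe_product, Set.mem_prod, Finset.mem_coe, Finset.mem_range,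
        Finset.mem_filter, Finset.mem_Icc] at hp hq hab
      have hij : i = j := le_antisymm
        (not_lt.1 (key i j a b hp.2.2 hq.2.2 hab)) (not_lt.1 (key j i b a hq.2.2 hp.2.2 hab.symm))
      subst hij
      simpa using hab)
  rw [Finset.card_product, Finset.card_range, Nat.card_Icc] at hcard
  rw [hAcard]
  omega

/-- If `ℕ \ P` contains a Δ-set, then every point `y` of the spacing shift
`Σ_P` satisfies `d*(y) = 0`. -/
theorem deltaSet_in_complement_implies_banachDensity_zero (P : Set ℕ)
    (h : IsDeltaSet Pᶜ) :
    ∀ y ∈ SpacingShift P, upperBanachDensity (supp y) = 0 := by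
  intro y hy
  obtain ⟨s, hs, hP⟩ := h
  refine Tendsto.limsup_eq ?_
  rw [Metric.tendsto_atTop]
  intro ε hε
  obtain ⟨k, hk⟩ := exists_nat_gt (2 / ε)
  have hk0 : (0 : ℝ) < k := lt_trans (by positivity) hk
  refine ⟨s k, fun n hn => ?_⟩
  rw [Real.dist_eq, sub_zero, abs_of_nonneg (Real.iSup_nonneg fun m => by positivity)]
  refine lt_of_le_of_lt (b := 2 / (k : ℝ)) (ciSup_le fun m => ?_) ?_
  · rw [div_le_div_iff₀ (by positivity) hk0]
    have hle : k * Nat.card (supp y ∩ Set.Icc m (m + n) : Set ℕ) ≤ 2 * (n + 1) := by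
      have := mul_card_supp_inter_Icc_le hs hP hy k m n
      omega
    rw [mul_comm]
    exact_mod_cast hle
  · rwa [div_lt_comm₀ (by positivity) hε]
end

section
/- Let P ⊆ ℕ. If every point y of the spacing shift Σ_P satisfies d(y) = 0 (the support A_y has density zero), then the topological entropy h_{σ_P} of the shift map on Σ_P is zero. -/
open Filter Topology

/-- If from every position one can move ahead by at most `N` steps through a block in which the
proportion of ones is less than `1 / q`, then long initial blocks contain few ones. -/
lemma mul_count_le_add_of_forall_exists_window {q N : ℕ} (x : ℕ → Bool)
    (hx : ∀ i, ∃ k ≤ N, q * Nat.count (fun j => x (i + j) = true) k < k) (n : ℕ) :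
    q * Nat.count (fun j => x j = true) n ≤ n + q * N := by
  induction n using Nat.strong_induction_on generalizing x with
  | _ n ih =>
    rcases le_or_gt n N with hn | hn
    · have h1 : Nat.count (fun j => x j = true) n ≤ n := Nat.count_le _
      exact (Nat.mul_le_mul_left q (h1.trans hn)).trans (Nat.le_add_left _ _)
    · obtain ⟨k, hkN, hk⟩ := hx 0
      simp only [zero_add] at hk
      obtain ⟨l, rfl⟩ := Nat.exists_eq_add_of_le (hkN.trans hn.le)
      have h2 := ih l (by omega) (fun j => x (k + j))
        (fun i => by simpa only [add_assoc] using hx (k + i))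
      rw [Nat.count_add, mul_add]
      omega

lemma isClosed_spacingShift (P : Set ℕ) : IsClosed (SpacingShift P) := by
  simp only [SpacingShift, Set.ofPred_forall]
  refine isClosed_iInter fun i => isClosed_iInter fun j => isClosed_iInter fun _ => ?_
  have : {x : ℕ → Bool | x i = true → x j = true → j - i ∈ P} =
      (fun x : ℕ → Bool => (x i, x j)) ⁻¹'
        {p : Bool × Bool | p.1 = true → p.2 = true → j - i ∈ P} := rfl
  rw [this]
  exact (isClosed_discrete _).preimage (by fun_prop)

lemma continuous_count (n : ℕ) :
    Continuous fun x : ℕ → Bool => Nat.count (fun j => x j = true) n := by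
  induction n with
  | zero => simpa using continuous_const
  | succ n ih =>
    simp only [Nat.count_succ]
    have h1 : Continuous fun x : ℕ → Bool => if x n = true then 1 else 0 :=
      (continuous_of_discreteTopology (f := fun b : Bool => if b = true then 1 else 0)).comp
        (continuous_apply n)
    exact ih.add h1

lemma exists_mem_spacingShift_forall_le_mul_count {P : Set ℕ} {q : ℕ}
    (hN : ∀ N : ℕ, ∃ y ∈ SpacingShift P, ∀ k ≤ N, k ≤ q * Nat.count (fun j => y j = true) k) :
    ∃ y ∈ SpacingShift P, ∀ k, k ≤ q * Nat.count (fun j => y j = true) k := by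
  let K : ℕ → Set (ℕ → Bool) := fun N =>
    SpacingShift P ∩ ⋂ k ≤ N, {y | k ≤ q * Nat.count (fun j => y j = true) k}
  have hclosed (N : ℕ) : IsClosed (K N) := (isClosed_spacingShift P).inter <|
    isClosed_iInter fun k => isClosed_iInter fun _ =>
      isClosed_le continuous_const (continuous_const.mul (continuous_count k))
  obtain ⟨y, hy⟩ := IsCompact.nonempty_iInter_of_sequence_nonempty_isCompact_isClosed K
    (fun N => Set.inter_subset_inter_right _ <|
      Set.biInter_mono (fun k (hk : k ≤ N) => Nat.le_succ_of_le hk) fun _ _ => subset_rfl)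
    (fun N => by
      obtain ⟨y, hy, hk⟩ := hN N
      exact ⟨y, hy, by simpa using hk⟩)
    (hclosed 0).isCompact hclosed
  rw [Set.mem_iInter] at hy
  exact ⟨y, (hy 0).1, fun k => by simpa using Set.mem_iInter₂.1 (hy k).2 k le_rfl⟩

lemma count_succ_le_card_supp_inter_Icc (y : ℕ → Bool) (n : ℕ) :
    Nat.count (fun j => y j = true) (n + 1) ≤ Nat.card (supp y ∩ Set.Icc 1 n : Set ℕ) + 1 := by
  classical
  have h1 : Nat.card (supp y ∩ Set.Icc 1 n : Set ℕ) =
      ((Finset.Icc 1 n).filter fun j => y j = true).card := by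
    rw [← Nat.card_eq_finsetCard]
    congr 2
    ext j
    simp [supp, and_comm]
  rw [h1, Nat.count_eq_card_filter_range]
  refine (Finset.card_le_card (t := insert 0 ((Finset.Icc 1 n).filter fun j => y j = true))
    fun j hj => ?_).trans (Finset.card_insert_le _ _)
  simp only [Finset.mem_filter, Finset.mem_range, Finset.mem_insert, Finset.mem_Icc] at hj ⊢
  rcases Nat.eq_zero_or_pos j with h0 | h0
  · exact Or.inl h0
  · exact Or.inr ⟨⟨h0, by omega⟩, hj.2⟩

lemma not_hasDensity_zero_of_forall_le_mul_count {y : ℕ → Bool} {q : ℕ}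
    (hy : ∀ k, k ≤ q * Nat.count (fun j => y j = true) k) : ¬ HasDensity (supp y) 0 := by
  intro hd
  have hq : 0 < q := Nat.pos_of_ne_zero fun h => by simpa [h] using hy 1
  have hq' : (0 : ℝ) < q := by exact_mod_cast hq
  have h1 := hd.eventually (gt_mem_nhds (show (0 : ℝ) < 1 / (2 * q) by positivity))
  obtain ⟨n, hn, hn2⟩ := (h1.and (eventually_ge_atTop (2 * q))).exists
  have hn0 : (0 : ℝ) < n := by exact_mod_cast (by omega : 0 < n)
  rw [div_lt_div_iff₀ hn0 (by positivity)] at hn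
  have h2 := (hy (n + 1)).trans (Nat.mul_le_mul_left q (count_succ_le_card_supp_inter_Icc y n))
  have h3 : Nat.card (supp y ∩ Set.Icc 1 n : Set ℕ) * (2 * q) < 1 * n := by exact_mod_cast hn
  nlinarith

lemma shift_mem_spacingShift {P : Set ℕ} {x : ℕ → Bool} (hx : x ∈ SpacingShift P) (i : ℕ) :
    (fun j => x (i + j)) ∈ SpacingShift P := fun a b hab ha hb => by
  simpa [Nat.add_sub_add_left] using hx (i + a) (i + b) (by omega) ha hb

/-- If all points of a spacing shift have density zero, then the proportion of ones in initial
blocks tends to zero uniformly. -/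
lemma eventually_forall_mul_count_le {P : Set ℕ}
    (h : ∀ y ∈ SpacingShift P, HasDensity (supp y) 0) (q : ℕ) :
    ∀ᶠ n in atTop, ∀ x ∈ SpacingShift P, q * Nat.count (fun j => x j = true) n ≤ n := by
  obtain ⟨N, hN⟩ : ∃ N : ℕ, ∀ y ∈ SpacingShift P,
      ∃ k ≤ N, 2 * q * Nat.count (fun j => y j = true) k < k := by
    by_contra! hcon
    obtain ⟨y, hy, hk⟩ := exists_mem_spacingShift_forall_le_mul_count hcon
    exact not_hasDensity_zero_of_forall_le_mul_count hk (h y hy)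
  filter_upwards [eventually_ge_atTop (2 * q * N)] with n hn x hx
  have := mul_count_le_add_of_forall_exists_window x
    (fun i => hN _ (shift_mem_spacingShift hx i)) n
  rw [mul_assoc] at this
  omega

/-- For every `b > 1`, there are at most `b ^ n` subsets of `{0, …, n - 1}` of sufficiently small
proportion. -/
lemma exists_card_filter_powerset_le_pow {b : ℝ} (hb : 1 < b) :
    ∃ q : ℕ, ∀ n : ℕ,
      (((Finset.range n).powerset.filter fun S => q * S.card ≤ n).card : ℝ) ≤ b ^ n := by
  have hb0 : 0 < b := by linarith
  set t : ℝ := (b - 1) / 2 with ht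
  have ht0 : 0 < t := by linarith
  set r : ℝ := (1 + t) / b with hr
  have hr0 : 0 < r := by positivity
  have hr1 : r < 1 := by rw [hr, div_lt_one hb0]; linarith
  obtain ⟨q, hq⟩ := exists_pow_lt_of_lt_one ht0 hr1
  refine ⟨q, fun n => ?_⟩
  set W := (Finset.range n).powerset.filter fun S => q * S.card ≤ n
  have h1 : (W.card : ℝ) * r ^ n ≤ (1 + t) ^ n := calc
    (W.card : ℝ) * r ^ n = ∑ S ∈ W, r ^ n := by simp
    _ ≤ ∑ S ∈ W, t ^ S.card := Finset.sum_le_sum fun S hS => calc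
        r ^ n ≤ r ^ (q * S.card) :=
          pow_le_pow_of_le_one hr0.le hr1.le (Finset.mem_filter.1 hS).2
        _ = (r ^ q) ^ S.card := pow_mul _ _ _
        _ ≤ t ^ S.card := pow_le_pow_left₀ (by positivity) hq.le _
    _ ≤ ∑ S ∈ (Finset.range n).powerset, t ^ S.card :=
        Finset.sum_le_sum_of_subset_of_nonneg (Finset.filter_subset _ _) fun _ _ _ => by positivity
    _ = (1 + t) ^ n := by
        simpa [add_comm] using Finset.sum_pow_mul_eq_add_pow t 1 (Finset.range n)
  have h2 : (1 + t) ^ n = b ^ n * r ^ n := by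
    rw [← mul_pow, hr, mul_div_cancel₀ _ hb0.ne']
  rw [h2] at h1
  exact le_of_mul_le_mul_right h1 (by positivity)

lemma exists_forall_agree_mem_of_mem_uniformity {U : SetRel (ℕ → Bool) (ℕ → Bool)}
    (hU : U ∈ uniformity (ℕ → Bool)) :
    ∃ m : ℕ, ∀ x y : ℕ → Bool, (∀ i < m, x i = y i) → (x, y) ∈ U := by
  rw [Pi.uniformity, mem_iInf] at hU
  obtain ⟨I, hI, V, hV, rfl⟩ := hU
  obtain ⟨m, hm⟩ := hI.bddAbove
  refine ⟨m + 1, fun x y hxy => Set.mem_iInter.2 fun i => ?_⟩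
  obtain ⟨t, ht, htV⟩ := mem_comap.1 (hV i)
  have hmem : (x i, y i) ∈ t := mem_uniformity_of_eq ht (hxy i (Nat.lt_succ_of_le (hm i.2)))
  exact htV hmem

lemma shift_iterate_apply (x : ℕ → Bool) (k i : ℕ) : shift^[k] x i = x (k + i) := by
  induction k generalizing x with
  | zero => simp
  | succ k ih => rw [Function.iterate_succ_apply, ih, shift]; congr 1; omega

open Classical in
/-- If initial blocks of length `n + m` of points of `F` have a proportion of ones at most `1 / q`,
then `F` is covered by as many dynamical balls as there are such blocks. -/
lemma coverMincard_shift_le {F : Set (ℕ → Bool)} {U : SetRel (ℕ → Bool) (ℕ → Bool)} {m n q : ℕ}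
    (hU : ∀ x y : ℕ → Bool, (∀ i < m, x i = y i) → (x, y) ∈ U)
    (hF : ∀ x ∈ F, q * Nat.count (fun j => x j = true) (n + m) ≤ n + m) :
    Dynamics.coverMincard shift F U n ≤
      ((Finset.range (n + m)).powerset.filter fun S => q * S.card ≤ n + m).card := by
  set W := (Finset.range (n + m)).powerset.filter fun S => q * S.card ≤ n + m
  let g : Finset ℕ → ℕ → Bool := fun S i => decide (i ∈ S)
  have hcover : Dynamics.IsDynCoverOf shift F U n (W.image g : Finset (ℕ → Bool)) := by
    intro x hx
    refine ⟨g ((Finset.range (n + m)).filter fun j => x j = true), ?_, ?_⟩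
    · refine Finset.mem_coe.2 (Finset.mem_image_of_mem g ?_)
      simp only [W, Finset.mem_filter, Finset.mem_powerset, Finset.filter_subset, true_and]
      rw [← Nat.count_eq_card_filter_range]
      exact hF x hx
    · refine Dynamics.mem_dynEntourage.2 fun k hk => hU _ _ fun i hi => ?_
      rw [shift_iterate_apply, shift_iterate_apply]
      have : k + i < n + m := by omega
      simp [g, this]
  exact hcover.coverMincard_le_card.trans (by exact_mod_cast Finset.card_image_le)

/-- If every point of `Σ_P` has support of density zero, then the
topological entropy of `(Σ_P, σ_P)` is zero. -/
theorem density_zero_implies_entropy_zero (P : Set ℕ)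
    (h : ∀ y ∈ SpacingShift P, HasDensity (supp y) 0) :
    Dynamics.coverEntropy shift (SpacingShift P) = 0 := by
  have hne : (SpacingShift P).Nonempty := ⟨fun _ => false, fun _ _ _ hi => by simp at hi⟩
  refine le_antisymm (iSup₂_le fun U hU => ?_) (Dynamics.coverEntropy_nonneg shift hne)
  obtain ⟨m, hm⟩ := exists_forall_agree_mem_of_mem_uniformity hU
  by_contra! hpos
  have hexp : (1 : ENNReal) <
      EReal.exp (Dynamics.coverEntropyEntourage shift (SpacingShift P) U) := by
    simpa using EReal.exp_strictMono hpos
  obtain ⟨b, hb1, hb⟩ := ENNReal.lt_iff_exists_nnreal_btwn.1 hexp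
  have hlog := ENNReal.log_strictMono hb
  rw [EReal.log_exp] at hlog
  refine hlog.not_ge ?_
  have hb1' : 1 < b := by exact_mod_cast hb1
  obtain ⟨q, hq⟩ := exists_card_filter_powerset_le_pow (b := b) (by exact_mod_cast hb1')
  rw [← ExpGrowth.expGrowthSup_pow]
  refine ExpGrowth.expGrowthSup_le_of_eventually_le (b := (b : ENNReal) ^ m)
    (ENNReal.pow_ne_top ENNReal.coe_ne_top) ?_
  filter_upwards [(tendsto_add_atTop_nat m).eventually (eventually_forall_mul_count_le h q)]
    with n hn
  have h1 := coverMincard_shift_le hm hn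
  have h2 := hq (n + m)
  rw [← pow_add, add_comm m n]
  refine (ENat.toENNReal_mono h1).trans ?_
  rw [ENat.toENNReal_coe]
  exact_mod_cast h2
end

section
/- Let P ⊆ ℕ. There exists a point y in the spacing shift Σ_P with d(y) > 0 (i.e. the density of the support A_y exists and is positive) if and only if there exists a point y' ∈ Σ_P with d*(y') > 0 (positive upper Banach density of the support). -/
open Filter Topology

/-- The number of ones of `x` in the window `[m, m + n)`. -/
def windowCount (x : ℕ → Bool) (m n : ℕ) : ℕ := Nat.count (fun i => x (m + i) = true) n

theorem windowCount_add (x : ℕ → Bool) (m a b : ℕ) :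
    windowCount x m (a + b) = windowCount x m a + windowCount x (m + a) b := by
  simp only [windowCount, Nat.count_add, add_assoc]

theorem windowCount_le (x : ℕ → Bool) (m n : ℕ) : windowCount x m n ≤ n :=
  Nat.count_le _

theorem windowCount_congr {x y : ℕ → Bool} {m m' n : ℕ}
    (h : ∀ i < n, x (m + i) = y (m' + i)) : windowCount x m n = windowCount y m' n := by
  simp only [windowCount, Nat.count_eq_card_filter_range]
  congr 1
  refine Finset.filter_congr fun i hi => ?_
  rw [h i (Finset.mem_range.1 hi)]

theorem natCard_supp_inter_Ico (x : ℕ → Bool) (m n : ℕ) :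
    Nat.card (supp x ∩ Set.Ico m (m + n) : Set ℕ) = windowCount x m n := by
  have h : (supp x ∩ Set.Ico m (m + n) : Set ℕ) =
      (((Finset.range n).filter fun i => x (m + i) = true).map (addLeftEmbedding m) :
        Finset ℕ) := by
    ext k
    simp only [supp, Set.mem_inter_iff, Set.mem_ofPred_eq, Set.mem_Ico, Finset.coe_map,
      Set.mem_image, Finset.mem_coe, Finset.mem_filter, Finset.mem_range,
      addLeftEmbedding_apply]
    constructor
    · rintro ⟨hk, hm, hn⟩
      exact ⟨k - m, ⟨by omega, by rwa [Nat.add_sub_cancel' hm]⟩, by omega⟩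
    · rintro ⟨i, ⟨hi, hx⟩, rfl⟩
      exact ⟨hx, by omega, by omega⟩
  rw [h, Nat.card_coe_set_eq, Set.ncard_coe_finset, Finset.card_map, windowCount,
    Nat.count_eq_card_filter_range]

theorem natCard_supp_inter_Icc_one (x : ℕ → Bool) (n : ℕ) :
    Nat.card (supp x ∩ Set.Icc 1 n : Set ℕ) = windowCount x 1 n := by
  rw [← natCard_supp_inter_Ico]
  congr 2
  ext k
  simp only [Set.mem_inter_iff, Set.mem_Icc, Set.mem_Ico]
  exact and_congr_right fun _ => by omega

theorem natCard_supp_inter_Icc (x : ℕ → Bool) (m n : ℕ) :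
    Nat.card (supp x ∩ Set.Icc m (m + n) : Set ℕ) = windowCount x m (n + 1) := by
  rw [← natCard_supp_inter_Ico]
  congr 2
  ext k
  simp only [Set.mem_inter_iff, Set.mem_Icc, Set.mem_Ico]
  exact and_congr_right fun _ => by omega

/-- The largest proportion of ones of `x` in a window of length `n + 1`. -/
noncomputable def maxWindowDensity (x : ℕ → Bool) (n : ℕ) : ℝ :=
  ⨆ m : ℕ, (windowCount x m (n + 1) : ℝ) / (n + 1)

theorem upperBanachDensity_supp (x : ℕ → Bool) :
    upperBanachDensity (supp x) = limsup (maxWindowDensity x) atTop := by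
  unfold upperBanachDensity maxWindowDensity
  simp only [natCard_supp_inter_Icc]

theorem windowCount_div_le_one (x : ℕ → Bool) (m n : ℕ) :
    (windowCount x m (n + 1) : ℝ) / (n + 1) ≤ 1 := by
  rw [div_le_one (by positivity)]
  exact_mod_cast windowCount_le x m (n + 1)

theorem windowCount_div_le_maxWindowDensity (x : ℕ → Bool) (m n : ℕ) :
    (windowCount x m (n + 1) : ℝ) / (n + 1) ≤ maxWindowDensity x n :=
  le_ciSup (f := fun m : ℕ => (windowCount x m (n + 1) : ℝ) / (n + 1))
    ⟨1, by rintro _ ⟨k, rfl⟩; exact windowCount_div_le_one x k n⟩ m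

theorem isBoundedUnder_le_maxWindowDensity (x : ℕ → Bool) :
    IsBoundedUnder (· ≤ ·) atTop (maxWindowDensity x) :=
  isBoundedUnder_of ⟨1, fun n => ciSup_le fun m => windowCount_div_le_one x m n⟩

theorem isCoboundedUnder_le_maxWindowDensity (x : ℕ → Bool) :
    IsCoboundedUnder (· ≤ ·) atTop (maxWindowDensity x) :=
  IsBoundedUnder.isCoboundedUnder_le <| isBoundedUnder_of
    ⟨0, fun n => (by positivity : (0 : ℝ) ≤ windowCount x 0 (n + 1) / (n + 1)).trans
      (windowCount_div_le_maxWindowDensity x 0 n)⟩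

/-- Every window splits greedily into sparse pieces of length at most `N`,
except for a remainder shorter than `N`. -/
theorem windowCount_le_of_forall_exists_sparse {x : ℕ → Bool} {c : ℝ} {N : ℕ} (hc : 0 ≤ c)
    (h : ∀ m, ∃ n ≤ N, (windowCount x m n : ℝ) < c * n) (m L : ℕ) :
    (windowCount x m L : ℝ) ≤ c * L + N := by
  induction L using Nat.strong_induction_on generalizing m with
  | _ L ih =>
    rcases le_total L N with hL | hL
    · have h1 : (windowCount x m L : ℝ) ≤ L := by exact_mod_cast windowCount_le x m L
      have h2 : (L : ℝ) ≤ N := by exact_mod_cast hL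
      nlinarith [mul_nonneg hc (Nat.cast_nonneg (α := ℝ) L)]
    · obtain ⟨n, hn, hlt⟩ := h m
      have hn0 : n ≠ 0 := by
        rintro rfl
        simp [windowCount] at hlt
      obtain ⟨k, rfl⟩ := Nat.exists_eq_add_of_le (hn.trans hL)
      have hk := ih k (by omega) (m + n)
      rw [windowCount_add]
      push_cast
      linarith

theorem exists_forall_le_windowCount {x : ℕ → Bool} {c : ℝ} (hc : 0 ≤ c)
    (hlt : c < limsup (maxWindowDensity x) atTop) (N : ℕ) :
    ∃ m, ∀ n ≤ N, c * n ≤ windowCount x m n := by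
  by_contra! hbad
  have hle : ∀ n, maxWindowDensity x n ≤ c + N / ((n : ℝ) + 1) := fun n => ciSup_le fun m => by
    have h := windowCount_le_of_forall_exists_sparse hc hbad m (n + 1)
    have hpos : (0 : ℝ) < n + 1 := by positivity
    rw [div_le_iff₀ hpos, add_mul, div_mul_cancel₀ _ hpos.ne']
    exact_mod_cast h
  have hlim : Tendsto (fun n : ℕ => c + N / ((n : ℝ) + 1)) atTop (𝓝 c) := by
    have h := (tendsto_one_div_add_atTop_nhds_zero_nat (𝕜 := ℝ)).const_mul (N : ℝ)
    simpa [div_eq_mul_inv] using h.const_add c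
  have h := limsup_le_limsup (Eventually.of_forall hle)
    (isCoboundedUnder_le_maxWindowDensity x) hlim.isBoundedUnder_le
  rw [hlim.limsup_eq] at h
  exact absurd hlt h.not_gt

/-- A limit of translates of `x` along windows of almost maximal density. -/
theorem exists_limit_forall_le_windowCount {x : ℕ → Bool}
    (hpos : 0 < limsup (maxWindowDensity x) atTop) :
    ∃ y : ℕ → Bool, (∀ k, ∃ m, ∀ i < k, x (m + i) = y i) ∧
      ∀ n : ℕ, limsup (maxWindowDensity x) atTop * n ≤ windowCount y 0 n := by
  set d := limsup (maxWindowDensity x) atTop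
  have hwin : ∀ N : ℕ, ∃ m, ∀ n ≤ N, d * (1 - 1 / ((N : ℝ) + 1)) * n ≤ windowCount x m n := by
    intro N
    have hinv : 1 / ((N : ℝ) + 1) ≤ 1 := by
      rw [div_le_one (by positivity)]
      linarith [Nat.cast_nonneg (α := ℝ) N]
    have hinv' : 0 < 1 / ((N : ℝ) + 1) := by positivity
    exact exists_forall_le_windowCount (mul_nonneg hpos.le (by linarith)) (by nlinarith) N
  choose m hm using hwin
  obtain ⟨y, φ, hφ, hy⟩ := CompactSpace.tendsto_subseq (fun N i => x (m N + i))
  have hagree : ∀ k, ∀ᶠ j in atTop, ∀ i < k, x (m (φ j) + i) = y i := fun k =>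
    (eventually_all_finite (Set.finite_Iio k)).2 fun i _ => by
      have h := tendsto_pi_nhds.1 hy i
      rw [nhds_discrete] at h
      exact tendsto_pure.1 h
  refine ⟨y, fun k => ?_, fun n => ?_⟩
  · obtain ⟨j, hj⟩ := (hagree k).exists
    exact ⟨_, hj⟩
  · have hlim : Tendsto (fun j => d * (1 - 1 / ((φ j : ℝ) + 1)) * n) atTop (𝓝 (d * n)) := by
      have h := (tendsto_one_div_add_atTop_nhds_zero_nat (𝕜 := ℝ)).comp hφ.tendsto_atTop
      simpa using ((h.const_sub 1).const_mul d).mul_const (n : ℝ)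
    refine le_of_tendsto hlim ?_
    filter_upwards [hagree n, hφ.tendsto_atTop.eventually_ge_atTop n] with j hj hn
    rw [← windowCount_congr (x := x) (m := m (φ j)) (by simpa using hj)]
    exact hm (φ j) n hn

/-- Prepend a zero to a sequence. -/
def consFalse (y : ℕ → Bool) : ℕ → Bool
  | 0 => false
  | i + 1 => y i

theorem windowCount_consFalse (y : ℕ → Bool) (n : ℕ) :
    windowCount (consFalse y) 1 n = windowCount y 0 n :=
  windowCount_congr fun i _ => by rw [Nat.add_comm 1 i, Nat.zero_add, consFalse]

theorem consFalse_mem_spacingShift {P : Set ℕ} {y : ℕ → Bool} (hy : y ∈ SpacingShift P) :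
    consFalse y ∈ SpacingShift P := by
  intro i j hij hi hj
  cases i with
  | zero => simp [consFalse] at hi
  | succ i =>
    cases j with
    | zero => simp [consFalse] at hj
    | succ j =>
      rw [Nat.add_sub_add_right]
      exact hy i j (by omega) hi hj

theorem mem_spacingShift_of_forall_exists_translate {P : Set ℕ} {x y : ℕ → Bool}
    (hx : x ∈ SpacingShift P) (h : ∀ k, ∃ m, ∀ i < k, x (m + i) = y i) :
    y ∈ SpacingShift P := by
  intro i j hij hi hj
  obtain ⟨m, hm⟩ := h (j + 1)
  have hmem := hx (m + i) (m + j) (by omega) (by rw [hm i (by omega), hi])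
    (by rw [hm j (by omega), hj])
  rwa [Nat.add_sub_add_left] at hmem

theorem hasDensity_supp_iff (x : ℕ → Bool) (d : ℝ) :
    HasDensity (supp x) d ↔
      Tendsto (fun n : ℕ => (windowCount x 1 (n + 1) : ℝ) / (n + 1)) atTop (𝓝 d) := by
  unfold HasDensity
  simp only [natCard_supp_inter_Icc_one]
  rw [← tendsto_add_atTop_iff_nat 1]
  simp only [Nat.cast_add, Nat.cast_one]

theorem le_upperBanachDensity_of_hasDensity {x : ℕ → Bool} {d : ℝ}
    (h : HasDensity (supp x) d) : d ≤ upperBanachDensity (supp x) := by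
  rw [hasDensity_supp_iff] at h
  rw [upperBanachDensity_supp, ← h.limsup_eq]
  exact limsup_le_limsup
    (Eventually.of_forall fun n => windowCount_div_le_maxWindowDensity x 1 n)
    h.isCoboundedUnder_le (isBoundedUnder_le_maxWindowDensity x)

theorem exists_hasDensity_upperBanachDensity {P : Set ℕ} {x : ℕ → Bool}
    (hx : x ∈ SpacingShift P) (hpos : 0 < upperBanachDensity (supp x)) :
    ∃ y ∈ SpacingShift P, HasDensity (supp y) (upperBanachDensity (supp x)) := by
  rw [upperBanachDensity_supp] at hpos ⊢
  obtain ⟨y, htrans, hcount⟩ := exists_limit_forall_le_windowCount hpos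
  refine ⟨consFalse y, consFalse_mem_spacingShift
    (mem_spacingShift_of_forall_exists_translate hx htrans), ?_⟩
  rw [hasDensity_supp_iff]
  simp only [windowCount_consFalse]
  refine tendsto_order.2 ⟨fun a ha => Eventually.of_forall fun n => ha.trans_le ?_,
    fun b hb => ?_⟩
  · rw [le_div_iff₀ (by positivity)]
    exact_mod_cast hcount (n + 1)
  · filter_upwards [eventually_lt_of_limsup_lt hb (isBoundedUnder_le_maxWindowDensity x)]
      with n hn
    obtain ⟨m, hm⟩ := htrans (n + 1)
    rw [← windowCount_congr (x := x) (m := m) (by simpa using hm)]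
    exact (windowCount_div_le_maxWindowDensity x m n).trans_lt hn

/-- There is `y ∈ Σ_P` whose support has (existing) positive density iff
there is `y' ∈ Σ_P` whose support has positive upper Banach density. -/
theorem pos_density_iff_pos_banachDensity (P : Set ℕ) :
    (∃ y ∈ SpacingShift P, ∃ d : ℝ, 0 < d ∧ HasDensity (supp y) d) ↔
      ∃ y' ∈ SpacingShift P, 0 < upperBanachDensity (supp y') := by
  constructor
  · rintro ⟨y, hy, d, hd, hdens⟩
    exact ⟨y, hy, hd.trans_le (le_upperBanachDensity_of_hasDensity hdens)⟩
  · rintro ⟨x, hx, hpos⟩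
    obtain ⟨y, hy, hdens⟩ := exists_hasDensity_upperBanachDensity hx hpos
    exact ⟨y, hy, _, hpos, hdens⟩
end

section
/- Every thick subset of ℕ is an IP−IP set: if T ⊆ ℕ contains arbitrarily long intervals of consecutive integers, then there exists an IP-set S ⊆ ℕ such that {s − t : s, t ∈ S, s > t} ⊆ T. -/
open Filter Topology

/-- If, around each `a n`, the interval of radius `∑ i < n, a i` is contained in `T`, and
`a n` exceeds that radius, then the positive differences of finite sums of `a` lie in `T`. -/
theorem sum_sub_sum_mem_of_Icc_subset {T : Set ℕ} {a : ℕ → ℕ}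
    (hlt : ∀ n, ∑ i ∈ Finset.range n, a i < a n)
    (hT : ∀ n, Set.Icc (a n - ∑ i ∈ Finset.range n, a i)
      (a n + ∑ i ∈ Finset.range n, a i) ⊆ T) (n : ℕ) :
    ∀ F G : Finset ℕ, F ⊆ Finset.range n → G ⊆ Finset.range n →
      ∑ i ∈ G, a i < ∑ i ∈ F, a i → ∑ i ∈ F, a i - ∑ i ∈ G, a i ∈ T := by
  induction n with
  | zero =>
    intro F G hF _ h
    simp [Finset.subset_empty.mp (by simpa using hF)] at h
  | succ n ih =>
    intro F G hF hG h
    have erase_subset : ∀ H : Finset ℕ, H ⊆ Finset.range (n + 1) →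
        H.erase n ⊆ Finset.range n := by
      intro H hH
      rwa [← Finset.subset_insert_iff, ← Finset.range_add_one]
    have hF' := erase_subset F hF
    have hG' := erase_subset G hG
    have hFle := Finset.sum_le_sum_of_subset (f := a) hF'
    have hGle := Finset.sum_le_sum_of_subset (f := a) hG'
    have hn := hlt n
    have key := ih (F.erase n) (G.erase n) hF' hG'
    by_cases hnF : n ∈ F <;> by_cases hnG : n ∈ G
    · rw [← Finset.add_sum_erase F a hnF, ← Finset.add_sum_erase G a hnG] at h ⊢
      rw [Nat.add_sub_add_left]
      exact key (by omega)
    · rw [Finset.erase_eq_of_notMem hnG] at hGle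
      rw [← Finset.add_sum_erase F a hnF]
      apply hT n
      constructor <;> omega
    · rw [Finset.erase_eq_of_notMem hnF] at hFle
      rw [← Finset.add_sum_erase G a hnG] at h
      omega
    · rw [Finset.erase_eq_of_notMem hnF, Finset.erase_eq_of_notMem hnG] at key
      exact key h

/-- Every thick subset of `ℕ` is an IP−IP set. -/
theorem thick_implies_IP_sub_IP (T : Set ℕ)
    (hT : ∀ N : ℕ, ∃ m : ℕ, Set.Icc m (m + N) ⊆ T) :
    ∃ S : Set ℕ, IsIPSet S ∧ ∀ s ∈ S, ∀ t ∈ S, t < s → s - t ∈ T := by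
  choose m hm using hT
  -- `P n` is the sum of the first `n` terms of the sequence being built.
  let P : ℕ → ℕ := fun n => Nat.rec 0 (fun _ p => p + (m (2 * p + 1) + p + 1)) n
  let a : ℕ → ℕ := fun n => m (2 * P n + 1) + P n + 1
  have hP : ∀ n, ∑ i ∈ Finset.range n, a i = P n := by
    intro n
    induction n with
    | zero => rfl
    | succ n ih => rw [Finset.sum_range_succ, ih]
  have hlt : ∀ n, ∑ i ∈ Finset.range n, a i < a n := by
    intro n
    rw [hP]
    simp only [a]
    omega
  refine ⟨FSseq a, ⟨a, fun n => (Nat.zero_le _).trans_lt (hlt n), subset_rfl⟩, ?_⟩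
  rintro _ ⟨F, -, rfl⟩ _ ⟨G, -, rfl⟩ h
  obtain ⟨n, hn⟩ := (F ∪ G).exists_nat_subset_range
  refine sum_sub_sum_mem_of_Icc_subset hlt (fun k => ?_) n F G
    (Finset.subset_union_left.trans hn) (Finset.subset_union_right.trans hn) h
  rw [hP]
  refine (Set.Icc_subset_Icc ?_ ?_).trans (hm (2 * P k + 1)) <;> simp only [a] <;> omega
end

section
/- Let P ⊆ ℕ. The topological entropy h_{σ_P} of the spacing shift (Σ_P, σ_P) is zero if and only if the complement E = ℕ \ P is a density intersective set, i.e. for every A ⊆ ℕ with positive upper Banach density, E intersects the difference set A − A = {a − a' : a, a' ∈ A, a > a'}. -/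
open Filter Topology

lemma iterate_shift_apply (x : ℕ → Bool) (k n : ℕ) : shift^[k] x n = x (k + n) := by
  induction k generalizing n with
  | zero => simp
  | succ k ih => rw [Function.iterate_succ_apply', shift, ih]; congr 1; omega

lemma iterate_shift_mem_spacingShift {P : Set ℕ} {x : ℕ → Bool} (hx : x ∈ SpacingShift P) (k : ℕ) :
    shift^[k] x ∈ SpacingShift P := by
  intro i j hij hi hj
  rw [iterate_shift_apply] at hi hj
  have := hx (k + i) (k + j) (by omega) hi hj
  rwa [Nat.add_sub_add_left] at this

/-- A point of a spacing shift stays in it when some of its ones are replaced by zeros. -/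
lemma mem_spacingShift_of_le {P : Set ℕ} {x y : ℕ → Bool} (hx : x ∈ SpacingShift P)
    (h : ∀ i, y i = true → x i = true) : y ∈ SpacingShift P :=
  fun i j hij hi hj => hx i j hij (h i hi) (h j hj)

lemma spacingShift_nonempty (P : Set ℕ) : (SpacingShift P).Nonempty :=
  ⟨fun _ => false, by simp [SpacingShift]⟩

/-- The number of ones among the first `n` coordinates of `x`. -/
def countOnes (x : ℕ → Bool) (n : ℕ) : ℕ := Nat.count (fun i => x i = true) n

lemma countOnes_add (x : ℕ → Bool) (a b : ℕ) :
    countOnes x (a + b) = countOnes x a + countOnes (shift^[a] x) b := by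
  simp only [countOnes, Nat.count_add, iterate_shift_apply]

lemma countOnes_le (x : ℕ → Bool) (n : ℕ) : countOnes x n ≤ n := Nat.count_le _

lemma continuous_countOnes (n : ℕ) : Continuous fun x : ℕ → Bool => countOnes x n := by
  simp only [countOnes, Nat.count_eq_card_filter_range, Finset.card_filter]
  refine continuous_finsetSum _ fun i _ => ?_
  exact (continuous_of_discreteTopology (f := fun b : Bool => if b = true then 1 else 0)).comp
    (continuous_apply i)

/-- If a word has density at least `2δ`, then some long final segment of it has all its prefixes
of density at least `δ`. -/
lemma exists_prefixes_dense {x : ℕ → Bool} {δ : ℝ} {N : ℕ} (h : 2 * δ * N ≤ countOnes x N) :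
    ∃ i ≤ N, δ * N ≤ (N - i : ℕ) ∧ ∀ k ≤ N - i, δ * k ≤ countOnes (shift^[i] x) k := by
  obtain ⟨i, hi, hmin⟩ := Finset.exists_min_image (Finset.range (N + 1))
    (fun k => (countOnes x k : ℝ) - δ * k) ⟨0, by simp⟩
  have hiN : i ≤ N := by simpa [Nat.lt_succ_iff] using hi
  refine ⟨i, hiN, ?_, fun k hk => ?_⟩
  · have h0 := hmin 0 (by simp)
    have hN : (countOnes x N : ℝ) = countOnes x i + countOnes (shift^[i] x) (N - i) := by
      exact_mod_cast (by rw [← countOnes_add, Nat.add_sub_cancel' hiN])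
    have hle : (countOnes (shift^[i] x) (N - i) : ℝ) ≤ (N - i : ℕ) := by
      exact_mod_cast countOnes_le _ _
    have hz : countOnes x 0 = 0 := by simp [countOnes]
    simp only [hz, Nat.cast_zero, mul_zero, sub_zero] at h0
    by_cases hδ : 0 ≤ δ
    · have : δ * i ≤ δ * N := by gcongr
      linarith
    · have : δ * N ≤ 0 := mul_nonpos_of_nonpos_of_nonneg (by linarith) (by positivity)
      exact this.trans (by positivity)
  · have := hmin (i + k) (by simp; omega)
    rw [countOnes_add] at this
    push_cast at this
    linarith

/-- If arbitrarily long words of a spacing shift have density at least `2δ`, then some point of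
the spacing shift has all its prefixes of density at least `δ`. -/
lemma exists_mem_spacingShift_dense {P : Set ℕ} {δ : ℝ} (hδ : 0 < δ)
    (h : ∃ᶠ N : ℕ in atTop, ∃ x ∈ SpacingShift P, 2 * δ * N ≤ countOnes x N) :
    ∃ x ∈ SpacingShift P, ∀ k : ℕ, δ * k ≤ countOnes x k := by
  let C : ℕ → Set (ℕ → Bool) := fun K =>
    SpacingShift P ∩ ⋂ (k : ℕ) (_ : k ≤ K), {x | δ * k ≤ countOnes x k}
  have hclosed : ∀ K, IsClosed (C K) := fun K =>
    (isClosed_spacingShift P).inter <| isClosed_iInter fun k => isClosed_iInter fun _ =>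
      isClosed_le continuous_const (continuous_of_discreteTopology.comp (continuous_countOnes k))
  obtain ⟨x, hx⟩ := IsCompact.nonempty_iInter_of_sequence_nonempty_isCompact_isClosed C
    (fun K => Set.inter_subset_inter_right _ <| Set.iInter_mono fun k =>
      Set.iInter_mono' fun hk => ⟨by omega, subset_rfl⟩)
    (fun K => by
      obtain ⟨M, hM⟩ := exists_nat_ge ((K : ℝ) / δ)
      obtain ⟨N, hN, x, hx, hxN⟩ := (frequently_atTop.1 h) M
      obtain ⟨i, -, hi, hk⟩ := exists_prefixes_dense hxN
      have hKN : K ≤ N - i := by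
        have h1 : (K : ℝ) ≤ δ * M := by rw [div_le_iff₀ hδ] at hM; linarith
        have h2 : δ * (M : ℝ) ≤ δ * N := by gcongr
        exact_mod_cast h1.trans (h2.trans hi)
      refine ⟨shift^[i] x, iterate_shift_mem_spacingShift hx i, ?_⟩
      simp only [Set.mem_iInter]
      exact fun k hkK => hk k (hkK.trans hKN))
    (hclosed 0).isCompact hclosed
  simp only [C, Set.mem_iInter, Set.mem_inter_iff] at hx
  exact ⟨x, (hx 0).1, fun k => (hx k).2 k le_rfl⟩

lemma card_inter_Icc_div_nonneg (A : Set ℕ) (m n : ℕ) :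
    0 ≤ (Nat.card (A ∩ Set.Icc m (m + n) : Set ℕ) : ℝ) / (n + 1) := by positivity

lemma card_inter_Icc_div_le_one (A : Set ℕ) (m n : ℕ) :
    (Nat.card (A ∩ Set.Icc m (m + n) : Set ℕ) : ℝ) / (n + 1) ≤ 1 := by
  rw [div_le_one (by positivity)]
  have := Set.ncard_le_ncard (Set.inter_subset_right (s := A) (t := Set.Icc m (m + n)))
  rw [← Nat.card_coe_set_eq, ← Nat.card_coe_set_eq, Nat.card_eq_fintype_card (α := Set.Icc _ _),
    Fintype.card_ofFinset, Nat.card_Icc] at this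
  exact_mod_cast this.trans (by omega)

lemma card_inter_Icc_eq_countOnes (A : Set ℕ) [DecidablePred (· ∈ A)] (m n : ℕ) :
    Nat.card (A ∩ Set.Icc m (m + n) : Set ℕ)
      = countOnes (shift^[m] fun i => decide (i ∈ A)) (n + 1) := by
  rw [countOnes, Nat.count_eq_card_filter_range, Nat.card_coe_set_eq, ← Set.ncard_coe_finset,
    eq_comm, ← Set.ncard_image_of_injective _ (add_right_injective m)]
  congr 1
  ext j
  simp only [iterate_shift_apply, Set.mem_inter_iff, Set.mem_Icc, Set.mem_image, Finset.coe_filter,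
    Finset.mem_range, Set.mem_ofPred_eq, decide_eq_true_eq]
  constructor
  · rintro ⟨k, ⟨h1, h2⟩, rfl⟩
    exact ⟨h2, by simp, by simp; omega⟩
  · rintro ⟨hj, h1, h2⟩
    exact ⟨j - m, ⟨by omega, by rwa [Nat.add_sub_cancel' h1]⟩, Nat.add_sub_cancel' h1⟩

lemma upperBanachDensity_pos_of_dense {x : ℕ → Bool} {δ : ℝ} (hδ : 0 < δ)
    (h : ∀ k : ℕ, δ * k ≤ countOnes x k) : 0 < upperBanachDensity (supp x) := by
  classical
  refine hδ.trans_le (le_limsup_of_frequently_le (Frequently.of_forall fun n => ?_) ?_)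
  · refine le_ciSup_of_le ⟨1, ?_⟩ 0 ?_
    · rintro _ ⟨m, rfl⟩
      exact card_inter_Icc_div_le_one _ _ _
    · rw [le_div_iff₀ (by positivity), card_inter_Icc_eq_countOnes,
        Function.iterate_zero_apply]
      have hx : (fun i => decide (i ∈ supp x)) = x := by
        funext i
        rw [Bool.eq_iff_iff, decide_eq_true_iff]
        rfl
      rw [hx]
      exact_mod_cast h (n + 1)
  · exact isBoundedUnder_of ⟨1, fun n => ciSup_le fun m => card_inter_Icc_div_le_one _ _ _⟩

lemma frequently_le_countOnes_of_upperBanachDensity_pos {A : Set ℕ} [DecidablePred (· ∈ A)]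
    (hA : 0 < upperBanachDensity A) : ∃ c : ℝ, 0 < c ∧ ∃ᶠ n : ℕ in atTop, ∃ m : ℕ,
      c * n ≤ countOnes (shift^[m] fun i => decide (i ∈ A)) n := by
  obtain ⟨c, hc, hcA⟩ := exists_between hA
  refine ⟨c, hc, ?_⟩
  have hfreq := frequently_lt_of_lt_limsup
    (isCoboundedUnder_le_of_le atTop fun n => Real.iSup_nonneg fun m =>
      card_inter_Icc_div_nonneg A m n) hcA
  refine (tendsto_add_atTop_nat 1).frequently (hfreq.mono fun n hn => ?_)
  obtain ⟨m, hm⟩ := exists_lt_of_lt_ciSup hn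
  refine ⟨m, ?_⟩
  rw [lt_div_iff₀ (by positivity), card_inter_Icc_eq_countOnes] at hm
  exact_mod_cast hm.le

/-- The number of subsets of an `N`-element set of size at most `c * N`, in exponential form. -/
lemma card_powerset_filter_le_exp {s c : ℝ} (hs : 0 ≤ s) (N : ℕ) :
    (((Finset.range N).powerset.filter fun T => (T.card : ℝ) ≤ c * N).card : ℝ)
      ≤ Real.exp (N * (s * c + Real.exp (-s))) := by
  set 𝒯 := (Finset.range N).powerset.filter fun T => (T.card : ℝ) ≤ c * N
  have hsum : ∑ T ∈ (Finset.range N).powerset, Real.exp (-s) ^ T.card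
      = (Real.exp (-s) + 1) ^ N := by
    simpa using Finset.sum_pow_mul_eq_add_pow (Real.exp (-s)) 1 (Finset.range N)
  calc (𝒯.card : ℝ) = ∑ T ∈ 𝒯, (1 : ℝ) := by simp
    _ ≤ ∑ T ∈ 𝒯, Real.exp (s * c * N) * Real.exp (-s) ^ T.card := by
        refine Finset.sum_le_sum fun T hT => ?_
        rw [← Real.exp_nat_mul, ← Real.exp_add]
        refine Real.one_le_exp ?_
        have := mul_le_mul_of_nonneg_left (Finset.mem_filter.1 hT).2 hs
        linarith
    _ ≤ ∑ T ∈ (Finset.range N).powerset, Real.exp (s * c * N) * Real.exp (-s) ^ T.card :=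
        Finset.sum_le_sum_of_subset_of_nonneg (Finset.filter_subset _ _)
          fun _ _ _ => by positivity
    _ = Real.exp (s * c * N) * (Real.exp (-s) + 1) ^ N := by rw [← Finset.mul_sum, hsum]
    _ ≤ Real.exp (s * c * N) * Real.exp (Real.exp (-s)) ^ N := by
        gcongr
        exact Real.add_one_le_exp _
    _ = Real.exp (N * (s * c + Real.exp (-s))) := by
        rw [← Real.exp_nat_mul, ← Real.exp_add]
        ring_nf

/-- Every entourage of `{0,1}^ℕ` is implied by agreement on a long enough initial segment. -/
lemma exists_prefix_of_mem_uniformity {U : SetRel (ℕ → Bool) (ℕ → Bool)}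
    (hU : U ∈ uniformity (ℕ → Bool)) :
    ∃ M : ℕ, ∀ x y : ℕ → Bool, (∀ i < M, x i = y i) → (x, y) ∈ U := by
  rw [Pi.uniformity] at hU
  obtain ⟨I, hI, V, hV, -, hUV, -⟩ := mem_iInf'.1 hU
  obtain ⟨M, hM⟩ := hI.bddAbove
  refine ⟨M + 1, fun x y hxy => ?_⟩
  rw [hUV]
  refine Set.mem_iInter₂.2 fun i hi => ?_
  obtain ⟨t, ht, htV⟩ := mem_comap.1 (hV i)
  refine htV ?_
  have : x i = y i := hxy i (Nat.lt_succ_of_le (hM hi))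
  simp only [Set.mem_preimage, this]
  exact mem_uniformity_of_eq ht rfl

/-- Sequences with few ones on an initial segment are covered by few dynamical balls. -/
lemma coverMincard_le_exp {F : Set (ℕ → Bool)} {U : SetRel (ℕ → Bool) (ℕ → Bool)} {M : ℕ}
    (hM : ∀ x y : ℕ → Bool, (∀ i < M, x i = y i) → (x, y) ∈ U) {s c : ℝ} (hs : 0 ≤ s) (n : ℕ)
    (hF : ∀ x ∈ F, (countOnes x (n + M) : ℝ) ≤ c * (n + M : ℕ)) :
    ((Dynamics.coverMincard shift F U n : ℕ∞) : ENNReal)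
      ≤ ENNReal.ofReal (Real.exp ((n + M : ℕ) * (s * c + Real.exp (-s)))) := by
  classical
  set 𝒯 := (Finset.range (n + M)).powerset.filter fun T => (T.card : ℝ) ≤ c * (n + M : ℕ)
  let S : Finset (ℕ → Bool) := 𝒯.image fun T i => decide (i ∈ T)
  have hS : Dynamics.IsDynCoverOf shift F U n (S : Set (ℕ → Bool)) := by
    intro x hx
    refine ⟨fun i => decide (i ∈ (Finset.range (n + M)).filter fun j => x j = true), ?_, ?_⟩
    · refine Finset.mem_coe.2 (Finset.mem_image_of_mem _ (Finset.mem_filter.2 ⟨?_, ?_⟩))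
      · exact Finset.mem_powerset.2 (Finset.filter_subset _ _)
      · rw [← Nat.count_eq_card_filter_range]
        exact hF x hx
    · rw [Dynamics.mem_dynEntourage]
      refine fun k hk => hM _ _ fun i hi => ?_
      have : k + i < n + M := by omega
      simp [iterate_shift_apply, this]
  calc ((Dynamics.coverMincard shift F U n : ℕ∞) : ENNReal) ≤ ((S.card : ℕ∞) : ENNReal) :=
        ENat.toENNReal_mono hS.coverMincard_le_card
    _ ≤ (𝒯.card : ENNReal) := by
        rw [ENat.toENNReal_coe]
        exact_mod_cast Finset.card_image_le
    _ = ENNReal.ofReal (𝒯.card : ℝ) := (ENNReal.ofReal_natCast _).symm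
    _ ≤ _ := ENNReal.ofReal_le_ofReal (card_powerset_filter_le_exp hs _)

/-- If the maximal density of ones in long words tends to zero, the entropy is at most zero. -/
lemma coverEntropy_shift_le_zero {F : Set (ℕ → Bool)}
    (hF : ∀ c : ℝ, 0 < c → ∀ᶠ N : ℕ in atTop, ∀ x ∈ F, (countOnes x N : ℝ) ≤ c * N) :
    Dynamics.coverEntropy shift F ≤ 0 := by
  refine iSup₂_le fun U hU => ExpGrowth.expGrowthSup_le_iff.2 fun b hb => ?_
  obtain ⟨M, hM⟩ := exists_prefix_of_mem_uniformity hU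
  obtain ⟨r, hr0, hrb⟩ := EReal.lt_iff_exists_real_btwn.1 hb
  have hr : 0 < r := by exact_mod_cast hr0
  obtain ⟨s, hs, hsr⟩ : ∃ s : ℝ, 0 < s ∧ Real.exp (-s) < r / 4 :=
    ((eventually_gt_atTop 0).and
      (Real.tendsto_exp_neg_atTop_nhds_zero.eventually_lt_const (by positivity))).exists
  have hc : 0 < r / (4 * s) := by positivity
  filter_upwards [(tendsto_add_atTop_nat M).eventually (hF _ hc), eventually_ge_atTop M]
    with n hn hMn
  refine (coverMincard_le_exp hM hs.le n hn).trans ?_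
  rw [← EReal.exp_coe]
  refine EReal.exp_monotone ?_
  have h1 : s * (r / (4 * s)) = r / 4 := by field_simp
  have h2 : ((n + M : ℕ) : ℝ) * (s * (r / (4 * s)) + Real.exp (-s)) ≤ r * n := by
    have hMn' : (M : ℝ) ≤ n := by exact_mod_cast hMn
    rw [h1]
    calc ((n + M : ℕ) : ℝ) * (r / 4 + Real.exp (-s)) ≤ (n + n) * (r / 4 + r / 4) := by
          push_cast
          gcongr
      _ = r * n := by ring
  calc _ ≤ ((r * n : ℝ) : EReal) := by exact_mod_cast h2
    _ = (r : EReal) * n := by simp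
    _ ≤ b * n := by gcongr

/-- All the words obtained by erasing ones from a word are distinguished by the dynamics. -/
lemma two_pow_countOnes_le_coverMincard {P : Set ℕ} {x : ℕ → Bool} (hx : x ∈ SpacingShift P)
    (n : ℕ) : ((2 ^ countOnes x n : ℕ) : ℕ∞) ≤
      Dynamics.coverMincard shift (SpacingShift P) {p | p.1 0 = p.2 0} n := by
  classical
  let B := (Finset.range n).filter fun i => x i = true
  let f : Finset ℕ → ℕ → Bool := fun T i => decide (i ∈ T)
  have hf : Function.Injective f := fun T T' h => by
    ext i
    simpa [f] using congrFun h i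
  let S : Finset (ℕ → Bool) := B.powerset.image f
  have hcard : S.card = 2 ^ countOnes x n := by
    rw [Finset.card_image_of_injective _ hf, Finset.card_powerset, countOnes,
      Nat.count_eq_card_filter_range]
  have hball : ∀ {y z : ℕ → Bool},
      z ∈ UniformSpace.ball y (Dynamics.dynEntourage shift {p | p.1 0 = p.2 0} n) →
        ∀ k < n, z k = y k := by
    intro y z hz k hk
    have := Dynamics.mem_dynEntourage.1 hz k hk
    simpa [iterate_shift_apply] using this.symm
  have hnet : Dynamics.IsDynNetIn shift (SpacingShift P) {p | p.1 0 = p.2 0} n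
      (S : Set (ℕ → Bool)) := by
    refine ⟨fun y hy => ?_, fun y hy z hz hyz => Set.disjoint_left.2 fun w hwy hwz => hyz ?_⟩
    · obtain ⟨T, hT, rfl⟩ := Finset.mem_image.1 (Finset.mem_coe.1 hy)
      refine mem_spacingShift_of_le hx fun i hi => ?_
      have := Finset.mem_powerset.1 hT (of_decide_eq_true hi)
      exact (Finset.mem_filter.1 this).2
    · obtain ⟨T, hT, rfl⟩ := Finset.mem_image.1 (Finset.mem_coe.1 hy)
      obtain ⟨T', hT', rfl⟩ := Finset.mem_image.1 (Finset.mem_coe.1 hz)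
      funext i
      by_cases hi : i < n
      · rw [← hball hwy i hi, hball hwz i hi]
      · have hnot : ∀ T ∈ B.powerset, i ∉ T := fun T hT hiT =>
          hi (Finset.mem_range.1 (Finset.mem_filter.1 (Finset.mem_powerset.1 hT hiT)).1)
        simp [f, hnot T hT, hnot T' hT']
  rw [← hcard]
  exact hnet.card_le_netMaxcard.trans (Dynamics.netMaxcard_le_coverMincard _ _ _)

lemma coverEntropy_spacingShift_pos {P : Set ℕ} {c : ℝ} (hc : 0 < c)
    (h : ∃ᶠ n : ℕ in atTop, ∃ x ∈ SpacingShift P, c * n ≤ countOnes x n) :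
    0 < Dynamics.coverEntropy shift (SpacingShift P) := by
  have hU : {p : (ℕ → Bool) × (ℕ → Bool) | p.1 0 = p.2 0} ∈ uniformity (ℕ → Bool) := by
    rw [Pi.uniformity]
    refine mem_iInf_of_mem 0 (mem_comap.2 ⟨SetRel.id, ?_, fun p hp => hp⟩)
    rw [DiscreteUniformity.eq_principal_setRelId]
    exact mem_principal_self _
  have hpos : (0 : EReal) < ((c * Real.log 2 : ℝ) : EReal) := by
    exact_mod_cast mul_pos hc (Real.log_pos one_lt_two)
  refine hpos.trans_le (le_trans ?_ (Dynamics.coverEntropyEntourage_le_coverEntropy _ _ hU))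
  refine Frequently.le_expGrowthSup (h.mono ?_)
  rintro n ⟨x, hx, hxn⟩
  calc EReal.exp (((c * Real.log 2 : ℝ) : EReal) * n)
      = ENNReal.ofReal (Real.exp (c * n * Real.log 2)) := by
        rw [← EReal.exp_coe, mul_right_comm c, EReal.coe_mul (c * Real.log 2)]
        rfl
    _ ≤ ENNReal.ofReal ((2 : ℝ) ^ countOnes x n) := by
        refine ENNReal.ofReal_le_ofReal ?_
        rw [← Real.exp_log (two_pos (α := ℝ)), ← Real.exp_nat_mul, Real.exp_log two_pos]
        gcongr
    _ = (((2 ^ countOnes x n : ℕ) : ℕ∞) : ENNReal) := by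
        rw [ENat.toENNReal_coe, ← ENNReal.ofReal_natCast]
        push_cast
        rfl
    _ ≤ _ := ENat.toENNReal_mono (two_pow_countOnes_le_coverMincard hx n)

/-- `h_{σ_P} = 0` iff `E = ℕ \ P` is a density intersective set. -/
theorem entropy_zero_iff_complement_densityIntersective (P : Set ℕ) :
    Dynamics.coverEntropy shift (SpacingShift P) = 0 ↔ DensityIntersective Pᶜ := by
  classical
  constructor
  · intro h A hA
    by_contra! hno
    have hmem : (fun i => decide (i ∈ A)) ∈ SpacingShift P := fun i j hij hi hj =>
      not_not.1 (hno j (of_decide_eq_true hj) i (of_decide_eq_true hi) hij)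
    obtain ⟨c, hc, hfreq⟩ := frequently_le_countOnes_of_upperBanachDensity_pos hA
    refine (coverEntropy_spacingShift_pos (P := P) hc (hfreq.mono ?_)).ne' h
    rintro n ⟨m, hm⟩
    exact ⟨_, iterate_shift_mem_spacingShift hmem m, hm⟩
  · intro h
    refine le_antisymm (coverEntropy_shift_le_zero fun c hc => ?_)
      (Dynamics.coverEntropy_nonneg _ (spacingShift_nonempty P))
    by_contra hno
    obtain ⟨x, hx, hdense⟩ := exists_mem_spacingShift_dense (P := P) (half_pos hc)
      ((not_eventually.1 hno).mono fun N hN => by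
        push Not at hN
        obtain ⟨x, hx, hxN⟩ := hN
        exact ⟨x, hx, by rw [mul_div_cancel₀ c two_ne_zero]; exact hxN.le⟩)
    obtain ⟨a, ha, a', ha', hlt, hP⟩ := h _ (upperBanachDensity_pos_of_dense (half_pos hc) hdense)
    exact hP (hx a' a hlt ha' ha)
end

section
/- The set of positive perfect squares {n² : n ∈ ℕ, n ≥ 1} contains no Δ-set: for every strictly increasing sequence (s_n) of natural numbers, some difference s_i − s_j with i > j is not a perfect square. -/
open Filter Topology

/-- The set of positive perfect squares contains no Δ-set: for every
strictly increasing sequence of natural numbers, some difference `s i - s j` (with `j < i`)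
is not a perfect square. -/
theorem squares_contain_no_deltaSet :
    ∀ s : ℕ → ℕ, StrictMono s → ∃ i j : ℕ, j < i ∧ ∀ k : ℕ, s i - s j ≠ k ^ 2 := by
  intro s hs
  by_contra! h
  have h01 : s 0 < s 1 := hs one_pos
  obtain ⟨d, hd⟩ := Nat.exists_eq_add_of_lt h01
  have hi : s 0 + (d + 1) ^ 2 + 2 ≤ s (s 0 + (d + 1) ^ 2 + 2) := hs.id_le _
  have h1i : s 1 < s (s 0 + (d + 1) ^ 2 + 2) := hs (by omega)
  obtain ⟨a, ha⟩ := h (s 0 + (d + 1) ^ 2 + 2) 0 (by omega)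
  obtain ⟨b, hb⟩ := h (s 0 + (d + 1) ^ 2 + 2) 1 (by omega)
  have hab : a ^ 2 = b ^ 2 + (d + 1) := by omega
  have hlt : b < a := lt_of_pow_lt_pow_left₀ 2 a.zero_le (by omega)
  have had : a ≤ d + 1 := by nlinarith
  have hsq : a ^ 2 ≤ (d + 1) ^ 2 := Nat.pow_le_pow_left had 2
  omega
end
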